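/- Let 𝓕 ⊆ 2^[n] be a nonempty s-extremal set system of VC-dimension at most 1. Then there exists F ∈ 𝓕 such that 𝓕 ∖ {F} is still s-extremal. -/

import Mathlib

open Finset

/-- The family of subsets of `[n]` (identified with `Fin n`) shattered by the
set system `F ⊆ 2^[n]`. -/
def Sh (n : ℕ) (F : Finset (Finset (Fin n))) : Finset (Finset (Fin n)) :=
  Finset.univ.filter (fun S => ∀ H ∈ S.powerset, ∃ A ∈ F, A ∩ S = H)

/-- A set system is shattering-extremal (s-extremal) if it shatters exactly
`|F|` sets. -/
def SExtremal (n : ℕ) (F : Finset (Finset (Fin n))) : Prop :=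
  (Sh n F).card = F.card

/-- The inclusion graph of a set system: vertices are the members of `F`,
two sets adjacent iff their symmetric difference is a single element. -/
def inclGraph (n : ℕ) (F : Finset (Finset (Fin n))) : SimpleGraph {A // A ∈ F} where
  Adj A B := (symmDiff A.1 B.1).card = 1
  symm := by constructor; intro A B h; rwa [symmDiff_comm]
  loopless := by constructor; intro A h; simp [symmDiff_self] at h

lemma Sh_eq_shatterer (n : ℕ) (F : Finset (Finset (Fin n))) : Sh n F = F.shatterer := by
  ext S
  simp [Sh, Shatters, inter_comm S]

/-- The members of `F` whose membership indicator at `x` equals `b`. -/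
def side {n : ℕ} (F : Finset (Finset (Fin n))) (x : Fin n) (b : Bool) : Finset (Finset (Fin n)) :=
  F.filter fun A => decide (x ∈ A) = b

lemma mem_side {n : ℕ} {F : Finset (Finset (Fin n))} {x : Fin n} {b : Bool} {A : Finset (Fin n)} :
    A ∈ side F x b ↔ A ∈ F ∧ decide (x ∈ A) = b := by
  simp [side]

lemma singleton_mem_Sh {n : ℕ} {F : Finset (Finset (Fin n))} {x : Fin n} :
    {x} ∈ Sh n F ↔ ∀ b, (side F x b).Nonempty := by
  simp only [Sh, mem_filter, mem_univ, true_and, mem_powerset, Finset.Nonempty, mem_side]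
  constructor
  · intro h b
    cases b
    · obtain ⟨A, hA, hAx⟩ := h ∅ (by simp)
      exact ⟨A, hA, by simpa [← disjoint_iff_inter_eq_empty] using hAx⟩
    · obtain ⟨A, hA, hAx⟩ := h {x} subset_rfl
      exact ⟨A, hA, by simpa using hAx⟩
  · intro h H hH
    obtain ⟨A, hA, hAx⟩ := h (decide (x ∈ H))
    refine ⟨A, hA, ?_⟩
    ext z
    have := @hH z
    grind

lemma pair_mem_Sh {n : ℕ} {F : Finset (Finset (Fin n))} {x y : Fin n}
    (h : ∀ b c, ∃ A ∈ F, decide (x ∈ A) = b ∧ decide (y ∈ A) = c) : {x, y} ∈ Sh n F := by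
  simp only [Sh, mem_filter, mem_univ, true_and, mem_powerset]
  intro H hH
  obtain ⟨A, hA, hAx, hAy⟩ := h (decide (x ∈ H)) (decide (y ∈ H))
  refine ⟨A, hA, ?_⟩
  ext z
  have := @hH z
  grind

/-- Two distinct members of `F` are separated by an element whose singleton is shattered. -/
lemma exists_separating {n : ℕ} {F : Finset (Finset (Fin n))} {A B : Finset (Fin n)}
    (hA : A ∈ F) (hB : B ∈ F) (hAB : A ≠ B) :
    ∃ y, decide (y ∈ A) ≠ decide (y ∈ B) ∧ ∀ b, (side F y b).Nonempty := by
  obtain ⟨y, hy⟩ : ∃ y, ¬(y ∈ A ↔ y ∈ B) := by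
    by_contra! h
    exact hAB (Finset.ext h)
  have hne : decide (y ∈ A) ≠ decide (y ∈ B) := by simpa using hy
  refine ⟨y, hne, fun b => ?_⟩
  by_cases hb : decide (y ∈ A) = b
  · exact ⟨A, mem_side.2 ⟨hA, hb⟩⟩
  · exact ⟨B, mem_side.2 ⟨hB, (Bool.eq_not.2 hne.symm).trans (Bool.eq_not.2 (Ne.symm hb)).symm⟩⟩

/-- In a set system of VC-dimension at most one with two members, some shattered singleton
has a one-element side. -/
lemma exists_side_eq_singleton {n : ℕ} {F : Finset (Finset (Fin n))} (hF : F.Nontrivial)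
    (hVC : ∀ S ∈ Sh n F, S.card ≤ 1) :
    ∃ x b A, (∀ c, (side F x c).Nonempty) ∧ side F x b = {A} := by
  obtain ⟨A₀, hA₀, B₀, hB₀, hne₀⟩ := hF
  obtain ⟨x₀, -, hx₀⟩ := exists_separating hA₀ hB₀ hne₀
  obtain ⟨⟨x, b⟩, hx, hmin⟩ := exists_min_image
    (univ.filter fun p : Fin n × Bool => ∀ c, (side F p.1 c).Nonempty)
    (fun p => (side F p.1 p.2).card) ⟨(x₀, true), by simpa using hx₀⟩
  simp only [mem_filter, mem_univ, true_and] at hx hmin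
  obtain ⟨A, hA⟩ := hx b
  refine ⟨x, b, A, hx, eq_singleton_iff_unique_mem.2 ⟨hA, fun B hB => ?_⟩⟩
  by_contra hBA
  obtain ⟨hAF, hAb⟩ := mem_side.1 hA
  obtain ⟨hBF, hBb⟩ := mem_side.1 hB
  obtain ⟨y, hy, hyne⟩ := exists_separating hBF hAF hBA
  obtain ⟨c, hc⟩ : ∃ c, side F y c ⊆ side F x b := by
    by_contra! hcon
    have hxy : x ≠ y := by
      rintro rfl
      exact hy (hBb.trans hAb.symm)
    have hS : ({x, y} : Finset (Fin n)) ∈ Sh n F := by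
      refine pair_mem_Sh fun d c => ?_
      by_cases hd : d = b
      · subst hd
        by_cases hc : decide (y ∈ A) = c
        · exact ⟨A, hAF, hAb, hc⟩
        · exact ⟨B, hBF, hBb, by grind⟩
      · obtain ⟨C, hC, hCx⟩ := not_subset.1 (hcon c)
        rw [mem_side] at hC hCx
        refine ⟨C, hC.1, ?_, hC.2⟩
        have hCb : decide (x ∈ C) ≠ b := fun h => hCx ⟨hC.1, h⟩
        exact (Bool.eq_not.2 hCb).trans (Bool.eq_not.2 hd).symm
    have := hVC _ hS
    rw [card_pair hxy] at this
    omega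
  have hss : side F y c ⊂ side F x b := by
    refine hc.ssubset_of_ne fun heq => hy ?_
    rw [← heq, mem_side] at hA hB
    exact hB.2.trans hA.2.symm
  exact (card_lt_card hss).not_ge (hmin (y, c) hyne)

/-- From a nonempty s-extremal set system of VC-dimension at
most 1 one can always delete a member so that the rest is still s-extremal. -/
theorem stmt19 (n : ℕ) (F : Finset (Finset (Fin n))) (hne : F.Nonempty)
    (hext : SExtremal n F) (hVC : ∀ S ∈ Sh n F, S.card ≤ 1) :
    ∃ A ∈ F, SExtremal n (F.erase A) := by
  rcases hne.exists_eq_singleton_or_nontrivial with ⟨A, rfl⟩ | hF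
  · exact ⟨A, by simp, by simp [SExtremal, Sh_eq_shatterer, shatterer, Shatters]⟩
  obtain ⟨x, b, A, hx, hA⟩ := exists_side_eq_singleton hF hVC
  have hAF : A ∈ F := (mem_side.1 (hA ▸ mem_singleton_self A)).1
  refine ⟨A, hAF, le_antisymm ?_ (Sh_eq_shatterer n _ ▸ card_le_card_shatterer _)⟩
  have hsub : Sh n (F.erase A) ⊆ (Sh n F).erase {x} := by
    intro S hS
    refine mem_erase.2 ⟨?_, ?_⟩
    · rintro rfl
      obtain ⟨B, hB⟩ := singleton_mem_Sh.1 hS b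
      obtain ⟨hBF, hBb⟩ := mem_side.1 hB
      have hBA : B ∈ side F x b := mem_side.2 ⟨mem_of_mem_erase hBF, hBb⟩
      rw [hA, mem_singleton] at hBA
      exact ne_of_mem_erase hBF hBA
    · rw [Sh_eq_shatterer] at hS ⊢
      exact shatterer_mono (erase_subset A F) hS
  calc (Sh n (F.erase A)).card ≤ ((Sh n F).erase {x}).card := card_le_card hsub
    _ = (F.erase A).card := by
      rw [card_erase_of_mem (singleton_mem_Sh.2 hx), card_erase_of_mem hAF, hext]
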